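/- Let f ∈ L²_loc(ℝ) satisfy: ⟨f, h_I⟩ = 0 for every dyadic interval I ∈ 𝔻 with I ⊄ [0,4], and |⟨f, h_I⟩| ≤ |I| for every I ∈ 𝔻. Let g ∈ L²_loc(ℝ) and set B := sup_{K ∈ 𝔻} ( (1/|K|) · Σ_{J ∈ 𝔻, J ⊆ K} |⟨g, h_J⟩|² )^{1/2}, assumed finite. Then there is an absolute constant C such that for every open set Ω ⊆ ℝ² with 0 < |Ω| < ∞: Σ_{I,J ∈ 𝔻, I×J ⊆ Ω} |⟨f, h_I⟩|² · |⟨g, h_J⟩|² ≤ C · B² · |Ω|. -/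

import Mathlib

open MeasureTheory Set
open scoped ENNReal NNReal

noncomputable section

/-- L²-normalized Haar wavelet of the interval `[a, b)`. -/
def haarW (a b : ℝ) (x : ℝ) : ℝ :=
  (Real.sqrt (b - a))⁻¹ *
    ((Ico a ((a + b) / 2)).indicator 1 x - (Ico ((a + b) / 2) b).indicator 1 x)

/-- Haar coefficient of `F : ℝ² → ℝ` on the rectangle `[a,b) × [c,d)`. -/
def haarCoef2 (F : ℝ × ℝ → ℝ) (a b c d : ℝ) : ℝ :=
  ∫ p : ℝ × ℝ, F p * (haarW a b p.1 * haarW c d p.2)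

/-- Left endpoint of the dyadic interval `2^k • [j, j+1)`. -/
def dyadL (k j : ℤ) : ℝ := (2:ℝ) ^ k * (j : ℝ)

/-- Right endpoint of the dyadic interval `2^k • [j, j+1)`. -/
def dyadR (k j : ℤ) : ℝ := (2:ℝ) ^ k * ((j : ℝ) + 1)

/-- The dyadic interval `2^k • [j, j+1)`. -/
def dyadI (k j : ℤ) : Set ℝ := Ico (dyadL k j) (dyadR k j)

/-- The dyadic rectangle indexed by `q = ((k₁,j₁),(k₂,j₂))`. -/
def dyadRect (q : (ℤ × ℤ) × ℤ × ℤ) : Set (ℝ × ℝ) :=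
  dyadI q.1.1 q.1.2 ×ˢ dyadI q.2.1 q.2.2

/-- One-dimensional Haar coefficient `⟨f, h_I⟩` on the dyadic interval of scale `k`,
position `j`. -/
def haarCoef1 (f : ℝ → ℝ) (k j : ℤ) : ℝ := ∫ x : ℝ, f x * haarW (dyadL k j) (dyadR k j) x

lemma dyadL_lt_dyadR (k j : ℤ) : dyadL k j < dyadR k j := by
  have : (0:ℝ) < 2 ^ k := by positivity
  unfold dyadL dyadR
  nlinarith

lemma volume_dyadI (k j : ℤ) : volume (dyadI k j) = ENNReal.ofReal ((2:ℝ) ^ k) := by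
  rw [dyadI, Real.volume_Ico]
  congr 1
  unfold dyadL dyadR
  ring

lemma measurableSet_dyadI (k j : ℤ) : MeasurableSet (dyadI k j) := measurableSet_Ico

/-- A dyadic interval meeting a dyadic interval of at least the same scale is contained in it. -/
lemma dyadI_subset_of_le {k k' j j' : ℤ} (h : k ≤ k')
    (hne : ¬ Disjoint (dyadI k j) (dyadI k' j')) : dyadI k j ⊆ dyadI k' j' := by
  obtain ⟨x, ⟨hx1, hx2⟩, hx3, hx4⟩ := Set.not_disjoint_iff.1 hne
  obtain ⟨n, rfl⟩ := Int.le.dest h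
  have hk : (0:ℝ) < 2 ^ k := by positivity
  have hn : (2:ℝ) ^ (k + (n:ℤ)) = 2 ^ k * ((2 ^ n : ℤ) : ℝ) := by
    rw [zpow_add₀ two_ne_zero]; simp
  simp only [dyadL, dyadR] at hx1 hx2 hx3 hx4
  rw [hn, mul_assoc] at hx3 hx4
  have h1 : ((2 ^ n * j' : ℤ) : ℝ) < ((j + 1 : ℤ) : ℝ) := by
    have := lt_of_mul_lt_mul_left (hx3.trans_lt hx2) hk.le
    push_cast at this ⊢; exact this
  have h2 : ((j : ℤ) : ℝ) < ((2 ^ n * (j' + 1) : ℤ) : ℝ) := by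
    have := lt_of_mul_lt_mul_left (hx1.trans_lt hx4) hk.le
    push_cast at this ⊢; exact this
  have h1' : ((2 ^ n * j' : ℤ) : ℝ) ≤ (j : ℝ) := by
    exact_mod_cast Int.lt_add_one_iff.1 (by exact_mod_cast h1)
  have h2' : (j : ℝ) + 1 ≤ ((2 ^ n * (j' + 1) : ℤ) : ℝ) := by
    exact_mod_cast Int.add_one_le_iff.2 (by exact_mod_cast h2)
  push_cast at h1' h2'
  apply Ico_subset_Ico
  · unfold dyadL
    rw [hn, mul_assoc]
    push_cast
    exact mul_le_mul_of_nonneg_left h1' hk.le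
  · unfold dyadR
    rw [hn, mul_assoc]
    push_cast
    exact mul_le_mul_of_nonneg_left h2' hk.le

lemma disjoint_dyadI_of_ne {k j j' : ℤ} (h : j ≠ j') : Disjoint (dyadI k j) (dyadI k j') := by
  by_contra hd
  have hk : (0:ℝ) < 2 ^ k := by positivity
  have h1 := (Ico_subset_Ico_iff (dyadL_lt_dyadR k j)).1 (dyadI_subset_of_le le_rfl hd)
  have h2 := (Ico_subset_Ico_iff (dyadL_lt_dyadR k j')).1
    (dyadI_subset_of_le le_rfl (fun hh => hd hh.symm))
  exact h (by exact_mod_cast mul_left_cancel₀ hk.ne' (le_antisymm h2.1 h1.1))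

/-- Summing over a family of dyadic intervals of bounded scale a weight satisfying a Carleson
packing condition costs at most the measure of the union of the family. -/
lemma tsum_le_mul_volume_iUnion {w : ℤ × ℤ → ℝ≥0∞} {A : ℝ≥0∞}
    (hw : ∀ k j : ℤ, ∑' s : {q : ℤ × ℤ // dyadI q.1 q.2 ⊆ dyadI k j}, w s.1 ≤
      A * volume (dyadI k j))
    {S : Set (ℤ × ℤ)} {N : ℤ} (hN : ∀ q ∈ S, q.1 ≤ N) :
    ∑' s : S, w s ≤ A * volume (⋃ q ∈ S, dyadI q.1 q.2) := by
  set M : Set (ℤ × ℤ) :=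
    {q | q ∈ S ∧ ∀ q' ∈ S, dyadI q.1 q.2 ⊆ dyadI q'.1 q'.2 → q'.1 ≤ q.1} with hM
  have hcover : S ⊆ ⋃ m : M, {q : ℤ × ℤ | dyadI q.1 q.2 ⊆ dyadI m.1.1 m.1.2} := by
    intro q hq
    obtain ⟨k, ⟨q', hq'S, hqq', rfl⟩, hmax⟩ := Int.exists_greatest_of_bdd
      (P := fun k => ∃ q' ∈ S, dyadI q.1 q.2 ⊆ dyadI q'.1 q'.2 ∧ q'.1 = k)
      ⟨N, by rintro _ ⟨q', h, -, rfl⟩; exact hN _ h⟩ ⟨q.1, q, hq, Subset.rfl, rfl⟩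
    exact mem_iUnion.2 ⟨⟨q', hq'S, fun r hr hr' => hmax _ ⟨r, hr, hqq'.trans hr', rfl⟩⟩, hqq'⟩
  have haux : ∀ p ∈ M, ∀ q ∈ M, p ≠ q → p.1 ≤ q.1 →
      Disjoint (dyadI p.1 p.2) (dyadI q.1 q.2) := by
    rintro ⟨k, j⟩ hp ⟨k', j'⟩ hq hne hle
    by_contra hd
    obtain rfl : k = k' := le_antisymm hle (hp.2 _ hq.1 (dyadI_subset_of_le hle hd))
    exact hd (disjoint_dyadI_of_ne fun h => hne (Prod.ext rfl h))
  have hdisj : Pairwise (Function.onFun Disjoint fun m : M => dyadI m.1.1 m.1.2) := by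
    intro p q hne
    have hne' : p.1 ≠ q.1 := fun h => hne (Subtype.ext h)
    rcases le_total p.1.1 q.1.1 with h | h
    · exact haux _ p.2 _ q.2 hne' h
    · exact (haux _ q.2 _ p.2 hne'.symm h).symm
  calc ∑' s : S, w s
      ≤ ∑' s : ⋃ m : M, {q : ℤ × ℤ | dyadI q.1 q.2 ⊆ dyadI m.1.1 m.1.2}, w s :=
        ENNReal.tsum_mono_subtype w hcover
    _ ≤ ∑' m : M, ∑' s : {q : ℤ × ℤ | dyadI q.1 q.2 ⊆ dyadI m.1.1 m.1.2}, w s :=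
        ENNReal.tsum_iUnion_le_tsum w _
    _ ≤ ∑' m : M, A * volume (dyadI m.1.1 m.1.2) := ENNReal.tsum_le_tsum fun m => hw _ _
    _ = A * volume (⋃ m : M, dyadI m.1.1 m.1.2) := by
        rw [ENNReal.tsum_mul_left, measure_iUnion hdisj fun m => measurableSet_dyadI _ _]
    _ ≤ A * volume (⋃ q ∈ S, dyadI q.1 q.2) := by
        gcongr
        exact iUnion_subset fun m => subset_biUnion_of_mem (u := fun q => dyadI q.1 q.2) m.2.1

lemma le_two_of_dyadI_subset {k j : ℤ} (h : dyadI k j ⊆ Icc 0 4) : k ≤ 2 := by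
  have hv := measure_mono (μ := volume) h
  rw [volume_dyadI, Real.volume_Icc, sub_zero,
    ENNReal.ofReal_le_ofReal_iff (by norm_num)] at hv
  have h4 : (2:ℝ) ^ k ≤ 2 ^ (2:ℤ) := by norm_num; exact hv
  exact (zpow_le_zpow_iff_right₀ (by norm_num)).1 h4

lemma tsum_zpow_le_two : ∑' k : ℤ, (if k ≤ 2 then ENNReal.ofReal ((2:ℝ) ^ k) else 0) = 8 := by
  have hinj : Function.Injective fun n : ℕ => (2:ℤ) - n := fun a b h => by
    simp only at h; omega
  rw [← hinj.tsum_eq]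
  · have : ∀ n : ℕ, (if (2:ℤ) - n ≤ 2 then ENNReal.ofReal ((2:ℝ) ^ ((2:ℤ) - n)) else 0) =
        4 * (2⁻¹ : ℝ≥0∞) ^ n := by
      intro n
      rw [if_pos (by omega), zpow_sub₀ two_ne_zero, div_eq_mul_inv,
        ENNReal.ofReal_mul (by positivity), zpow_natCast, ← inv_pow,
        ENNReal.ofReal_pow (by positivity), ENNReal.ofReal_inv_of_pos two_pos]
      norm_num
    simp only [this]
    rw [ENNReal.tsum_mul_left, ENNReal.tsum_geometric, ENNReal.one_sub_inv_two, inv_inv]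
    norm_num
  · intro k hk
    simp only [Function.mem_support, ne_eq, ite_eq_right_iff, Classical.not_imp] at hk
    exact ⟨(2 - k).toNat, by have := hk.1; simp only; omega⟩

/-- The union of the dyadic `J` with `I × J ⊆ Ω`, where `I` is the dyadic interval indexed by
`p`. -/
def dyadFiber (Ω : Set (ℝ × ℝ)) (p : ℤ × ℤ) : Set ℝ :=
  ⋃ q ∈ {q : ℤ × ℤ | dyadRect (p, q) ⊆ Ω}, dyadI q.1 q.2

lemma measurableSet_dyadFiber (Ω : Set (ℝ × ℝ)) (p : ℤ × ℤ) : MeasurableSet (dyadFiber Ω p) :=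
  MeasurableSet.biUnion (to_countable _) fun _ _ => measurableSet_dyadI _ _

lemma dyadI_prod_dyadFiber_subset (Ω : Set (ℝ × ℝ)) (p : ℤ × ℤ) :
    dyadI p.1 p.2 ×ˢ dyadFiber Ω p ⊆ Ω := by
  rintro ⟨x, y⟩ ⟨hx, hy⟩
  obtain ⟨q, hq, hyq⟩ := mem_iUnion₂.1 hy
  exact hq ⟨hx, hyq⟩

lemma tsum_volume_dyadFiber_le (Ω : Set (ℝ × ℝ)) (k : ℤ) :
    ∑' j : ℤ, ENNReal.ofReal ((2:ℝ) ^ k) * volume (dyadFiber Ω (k, j)) ≤ volume Ω := by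
  calc ∑' j : ℤ, ENNReal.ofReal ((2:ℝ) ^ k) * volume (dyadFiber Ω (k, j))
      = ∑' j : ℤ, volume (dyadI k j ×ˢ dyadFiber Ω (k, j)) := by
        simp only [Measure.volume_eq_prod, Measure.prod_prod, volume_dyadI]
    _ = volume (⋃ j : ℤ, dyadI k j ×ˢ dyadFiber Ω (k, j)) := by
        refine (measure_iUnion ?_ fun j =>
          (measurableSet_dyadI _ _).prod (measurableSet_dyadFiber _ _)).symm
        exact fun i j hij => Disjoint.set_prod_left (disjoint_dyadI_of_ne hij) _ _
    _ ≤ volume Ω := measure_mono (iUnion_subset fun j => dyadI_prod_dyadFiber_subset Ω (k, j))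

lemma exists_scale_bound {Ω : Set (ℝ × ℝ)} (hΩ : volume Ω < ⊤) (p : ℤ × ℤ) :
    ∃ N : ℤ, ∀ q ∈ {q : ℤ × ℤ | dyadRect (p, q) ⊆ Ω}, q.1 ≤ N := by
  have hp : (0:ℝ) < 2 ^ p.1 := by positivity
  obtain ⟨n, hn⟩ := pow_unbounded_of_one_lt ((volume Ω).toReal / 2 ^ p.1)
    (one_lt_two : (1:ℝ) < 2)
  refine ⟨n, fun q hq => ?_⟩
  have hv := measure_mono (μ := volume) (show dyadRect (p, q) ⊆ Ω from hq)
  rw [dyadRect, Measure.volume_eq_prod, Measure.prod_prod, volume_dyadI, volume_dyadI,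
    ← ENNReal.ofReal_mul hp.le, ← Measure.volume_eq_prod,
    ENNReal.ofReal_le_iff_le_toReal hΩ.ne] at hv
  rw [div_lt_iff₀ hp] at hn
  have h2 : (2:ℝ) ^ q.1 < 2 ^ (n:ℤ) := by
    rw [zpow_natCast]
    exact lt_of_mul_lt_mul_left (hv.trans_lt (hn.trans_eq (mul_comm _ _))) hp.le
  exact ((zpow_lt_zpow_iff_right₀ one_lt_two).1 h2).le

/-- Claim 3.4 of the paper (Claim 1): the dyadic biparameter BMO bound for a tensor
product `f ⊗ g` where the Haar coefficients of `f` are of size at most `|I|`, localized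
in `[0,4]`, in terms of the one-parameter dyadic BMO norm `B` of `g`. -/
theorem tensor_bmo_bound :
    ∃ C : ℝ, 0 < C ∧
      ∀ f g : ℝ → ℝ,
        Measurable f → LocallyIntegrable (fun x => (f x) ^ 2) volume →
        Measurable g → LocallyIntegrable (fun x => (g x) ^ 2) volume →
        (∀ k j : ℤ, ¬ dyadI k j ⊆ Icc (0:ℝ) 4 → haarCoef1 f k j = 0) →
        (∀ k j : ℤ, |haarCoef1 f k j| ≤ (2:ℝ) ^ k) →
        ∀ B : ℝ, 0 ≤ B →
          (∀ k j : ℤ,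
            (∑' s : {q : ℤ × ℤ // dyadI q.1 q.2 ⊆ dyadI k j},
                ENNReal.ofReal ((haarCoef1 g s.1.1 s.1.2) ^ 2)) ≤
              ENNReal.ofReal (B ^ 2 * (2:ℝ) ^ k)) →
          ∀ Ω : Set (ℝ × ℝ), IsOpen Ω → 0 < volume Ω → volume Ω < ⊤ →
            (∑' r : {q : (ℤ × ℤ) × ℤ × ℤ // dyadRect q ⊆ Ω},
                ENNReal.ofReal ((haarCoef1 f r.1.1.1 r.1.1.2) ^ 2 *
                  (haarCoef1 g r.1.2.1 r.1.2.2) ^ 2)) ≤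
              ENNReal.ofReal (C * B ^ 2) * volume Ω := by
  refine ⟨8, by norm_num, ?_⟩
  intro f g _ _ _ _ hf0 hf B hB hg Ω _ _ hΩ
  set A : ℝ≥0∞ := ENNReal.ofReal (B ^ 2)
  set w : ℤ × ℤ → ℝ≥0∞ := fun q => ENNReal.ofReal ((haarCoef1 g q.1 q.2) ^ 2)
  set v : ℤ × ℤ → ℝ≥0∞ := fun p => ENNReal.ofReal ((haarCoef1 f p.1 p.2) ^ 2)
  have hw : ∀ k j : ℤ, ∑' s : {q : ℤ × ℤ // dyadI q.1 q.2 ⊆ dyadI k j}, w s.1 ≤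
      A * volume (dyadI k j) := fun k j => by
    rw [volume_dyadI, ← ENNReal.ofReal_mul (sq_nonneg B)]
    exact hg k j
  have hv : ∀ k j : ℤ, v (k, j) ≤ (if k ≤ 2 then ENNReal.ofReal ((2:ℝ) ^ k) else 0) *
      ENNReal.ofReal ((2:ℝ) ^ k) := fun k j => by
    by_cases hk : dyadI k j ⊆ Icc 0 4
    · rw [if_pos (le_two_of_dyadI_subset hk), ← ENNReal.ofReal_mul (by positivity), ← sq]
      exact ENNReal.ofReal_le_ofReal (sq_le_sq' (abs_le.1 (hf k j)).1 (abs_le.1 (hf k j)).2)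
    · simp [v, hf0 k j hk]
  have hfiber : ∀ p : ℤ × ℤ, ∑' s : {q : ℤ × ℤ | dyadRect (p, q) ⊆ Ω}, w s ≤
      A * volume (dyadFiber Ω p) := fun p => by
    obtain ⟨N, hN⟩ := exists_scale_bound hΩ p
    exact tsum_le_mul_volume_iUnion hw hN
  calc ∑' r : {q : (ℤ × ℤ) × ℤ × ℤ // dyadRect q ⊆ Ω},
        ENNReal.ofReal ((haarCoef1 f r.1.1.1 r.1.1.2) ^ 2 * (haarCoef1 g r.1.2.1 r.1.2.2) ^ 2)
      = ∑' r : {q : (ℤ × ℤ) × ℤ × ℤ | dyadRect q ⊆ Ω}, v r.1.1 * w r.1.2 :=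
        tsum_congr fun r => ENNReal.ofReal_mul (sq_nonneg _)
    _ = ∑' p : ℤ × ℤ, v p * ∑' s : {q : ℤ × ℤ | dyadRect (p, q) ⊆ Ω}, w s := by
        rw [tsum_subtype {q : (ℤ × ℤ) × ℤ × ℤ | dyadRect q ⊆ Ω} fun r => v r.1 * w r.2,
          ENNReal.tsum_prod']
        refine tsum_congr fun p => ?_
        rw [tsum_subtype, ← ENNReal.tsum_mul_left]
        refine tsum_congr fun q => ?_
        by_cases h : dyadRect (p, q) ⊆ Ω <;> simp [h]
    _ ≤ ∑' p : ℤ × ℤ, v p * (A * volume (dyadFiber Ω p)) := by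
        gcongr with p
        exact hfiber p
    _ = ∑' k : ℤ, ∑' j : ℤ, v (k, j) * (A * volume (dyadFiber Ω (k, j))) := ENNReal.tsum_prod'
    _ ≤ ∑' k : ℤ, ∑' j : ℤ, (if k ≤ 2 then ENNReal.ofReal ((2:ℝ) ^ k) else 0) *
          (A * (ENNReal.ofReal ((2:ℝ) ^ k) * volume (dyadFiber Ω (k, j)))) := by
        refine ENNReal.tsum_le_tsum fun k => ENNReal.tsum_le_tsum fun j => ?_
        refine (mul_le_mul_left (hv k j) _).trans_eq ?_
        ring
    _ ≤ ∑' k : ℤ, (if k ≤ 2 then ENNReal.ofReal ((2:ℝ) ^ k) else 0) * (A * volume Ω) := by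
        refine ENNReal.tsum_le_tsum fun k => ?_
        rw [ENNReal.tsum_mul_left, ENNReal.tsum_mul_left]
        gcongr
        exact tsum_volume_dyadFiber_le Ω k
    _ = ENNReal.ofReal (8 * B ^ 2) * volume Ω := by
        rw [ENNReal.tsum_mul_right, tsum_zpow_le_two, ENNReal.ofReal_mul (by norm_num), mul_assoc]
        norm_num [A]
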